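/- Let V₁, V₂ be complex vector spaces with sl₂-actions and v₁, v₂ primitive vectors of weights m₁, m₂ (nonnegative integers). For every integer 0 ≤ l ≤ min(m₁,m₂), the vector ⟨v₁,v₂⟩_l is an eigenvector of Ω₁₂ = e₁⊗f₂ + f₁⊗e₂ + ½h₁⊗h₂: Ω₁₂ ⟨v₁,v₂⟩_l = (l(l−m₁−m₂−1) + m₁m₂/2) · ⟨v₁,v₂⟩_l. -/

import Mathlib

open scoped TensorProduct

/-- An sl₂-action on a complex vector space `V`. -/
def IsSl2Action {V : Type*} [AddCommGroup V] [Module ℂ V]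
    (e f h : Module.End ℂ V) : Prop :=
  h ∘ₗ e - e ∘ₗ h = (2 : ℂ) • e ∧ h ∘ₗ f - f ∘ₗ h = (-2 : ℂ) • f ∧ e ∘ₗ f - f ∘ₗ e = h

/-- The falling factorial `(x)_n = x(x−1)⋯(x−n+1)`, with `(x)_0 = 1`. -/
noncomputable def fallFac (x : ℂ) (n : ℕ) : ℂ := ∏ i ∈ Finset.range n, (x - i)

/-- The vector `⟨v₁,v₂⟩_l = Σ_{p=0}^{l} (−1)^p/((m₁)_p (m₂)_{l−p}) · (fᵖv₁)/p! ⊗ (f^{l−p}v₂)/(l−p)!`. -/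
noncomputable def singVec {V₁ V₂ : Type*} [AddCommGroup V₁] [Module ℂ V₁]
    [AddCommGroup V₂] [Module ℂ V₂]
    (f₁ : Module.End ℂ V₁) (f₂ : Module.End ℂ V₂) (v₁ : V₁) (v₂ : V₂)
    (m₁ m₂ l : ℕ) : V₁ ⊗[ℂ] V₂ :=
  ∑ p ∈ Finset.range (l + 1),
    ((-1 : ℂ) ^ p /
        (fallFac (m₁ : ℂ) p * fallFac (m₂ : ℂ) (l - p) *
          (Nat.factorial p : ℂ) * (Nat.factorial (l - p) : ℂ))) •
      (((f₁ ^ p) v₁) ⊗ₜ[ℂ] ((f₂ ^ (l - p)) v₂))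

/-- The operator `Ω₁₂ = e₁ ⊗ f₂ + f₁ ⊗ e₂ + ½ h₁ ⊗ h₂` on `V₁ ⊗ V₂`. -/
noncomputable def Omega12 {V₁ V₂ : Type*} [AddCommGroup V₁] [Module ℂ V₁]
    [AddCommGroup V₂] [Module ℂ V₂]
    (e₁ f₁ h₁ : Module.End ℂ V₁) (e₂ f₂ h₂ : Module.End ℂ V₂) :
    Module.End ℂ (V₁ ⊗[ℂ] V₂) :=
  TensorProduct.map e₁ f₂ + TensorProduct.map f₁ e₂ + (2⁻¹ : ℂ) • TensorProduct.map h₁ h₂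

lemma fallFac_succ (x : ℂ) (n : ℕ) : fallFac x (n + 1) = fallFac x n * (x - n) :=
  Finset.prod_range_succ _ _

lemma fallFac_natCast_ne_zero {m n : ℕ} (h : n ≤ m) : fallFac (m : ℂ) n ≠ 0 := by
  refine Finset.prod_ne_zero_iff.mpr fun i hi => sub_ne_zero.mpr ?_
  have := Finset.mem_range.mp hi
  exact_mod_cast (show m ≠ i by omega)

section Primitive

variable {V : Type*} [AddCommGroup V] [Module ℂ V] {e f h : Module.End ℂ V} {v : V} {m : ℂ}

lemma IsSl2Action.h_pow_f (H : IsSl2Action e f h) (hv : h v = m • v) (p : ℕ) :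
    h ((f ^ p) v) = (m - 2 * p) • (f ^ p) v := by
  induction p with
  | zero => simp [hv]
  | succ p ih =>
    have hf := LinearMap.congr_fun H.2.1 ((f ^ p) v)
    simp only [LinearMap.sub_apply, LinearMap.comp_apply, LinearMap.smul_apply, ih, map_smul,
      sub_eq_iff_eq_add] at hf
    rw [pow_succ', Module.End.mul_apply, hf]
    push_cast
    module

lemma IsSl2Action.e_pow_succ_f (H : IsSl2Action e f h) (he : e v = 0) (hv : h v = m • v) (p : ℕ) :
    e ((f ^ (p + 1)) v) = ((p + 1) * (m - p)) • (f ^ p) v := by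
  induction p with
  | zero =>
    have hef := LinearMap.congr_fun H.2.2 v
    simp only [LinearMap.sub_apply, LinearMap.comp_apply, he, map_zero, sub_zero, hv] at hef
    simp [hef]
  | succ p ih =>
    have hef := LinearMap.congr_fun H.2.2 ((f ^ (p + 1)) v)
    simp only [LinearMap.sub_apply, LinearMap.comp_apply, H.h_pow_f hv, ih, map_smul,
      sub_eq_iff_eq_add] at hef
    rw [pow_succ' f (p + 1), Module.End.mul_apply, hef, pow_succ' f p, Module.End.mul_apply]
    push_cast
    module

end Primitive

/-- The coefficient of `fᵖv₁ ⊗ f^q v₂` in `⟨v₁,v₂⟩_{p+q}`. -/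
noncomputable def singCoeff (m₁ m₂ p q : ℕ) : ℂ :=
  (-1 : ℂ) ^ p / (fallFac (m₁ : ℂ) p * fallFac (m₂ : ℂ) q *
    (Nat.factorial p : ℂ) * (Nat.factorial q : ℂ))

lemma singCoeff_succ_left {m₁ m₂ p q : ℕ} (hp : p + 1 ≤ m₁) (hq : q + 1 ≤ m₂) :
    singCoeff m₁ m₂ (p + 1) q * ((p + 1) * (m₁ - p)) =
      -(singCoeff m₁ m₂ p (q + 1) * ((q + 1) * (m₂ - q))) := by
  have hp' := fallFac_natCast_ne_zero hp
  have hq' := fallFac_natCast_ne_zero hq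
  rw [fallFac_succ] at hp' hq'
  obtain ⟨a, b⟩ := mul_ne_zero_iff.mp hp'
  obtain ⟨c, d⟩ := mul_ne_zero_iff.mp hq'
  have hp1 : (p : ℂ) + 1 ≠ 0 := by exact_mod_cast p.succ_ne_zero
  have hq1 : (q : ℂ) + 1 ≠ 0 := by exact_mod_cast q.succ_ne_zero
  have hpf : (p.factorial : ℂ) ≠ 0 := by exact_mod_cast p.factorial_ne_zero
  have hqf : (q.factorial : ℂ) ≠ 0 := by exact_mod_cast q.factorial_ne_zero
  simp only [singCoeff, fallFac_succ, Nat.factorial_succ, Nat.cast_mul, Nat.cast_add, Nat.cast_one]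
  field_simp
  ring

/-- `⟨v₁,v₂⟩_l` is an eigenvector of `Ω₁₂` with eigenvalue `l(l−m₁−m₂−1) + m₁m₂/2`. -/
theorem omega12_eigenvector_singVec
    {V₁ V₂ : Type*} [AddCommGroup V₁] [Module ℂ V₁] [AddCommGroup V₂] [Module ℂ V₂]
    (e₁ f₁ h₁ : Module.End ℂ V₁) (e₂ f₂ h₂ : Module.End ℂ V₂)
    (hsl1 : IsSl2Action e₁ f₁ h₁) (hsl2 : IsSl2Action e₂ f₂ h₂)
    (m₁ m₂ : ℕ) (v₁ : V₁) (v₂ : V₂)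
    (hv₁e : e₁ v₁ = 0) (hv₁h : h₁ v₁ = (m₁ : ℂ) • v₁)
    (hv₂e : e₂ v₂ = 0) (hv₂h : h₂ v₂ = (m₂ : ℂ) • v₂)
    (l : ℕ) (hl : l ≤ min m₁ m₂) :
    Omega12 e₁ f₁ h₁ e₂ f₂ h₂ (singVec f₁ f₂ v₁ v₂ m₁ m₂ l) =
      ((l : ℂ) * ((l : ℂ) - (m₁ : ℂ) - (m₂ : ℂ) - 1) + (m₁ : ℂ) * (m₂ : ℂ) / 2) •
        singVec f₁ f₂ v₁ v₂ m₁ m₂ l := by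
  obtain ⟨hl₁, hl₂⟩ := le_min_iff.mp hl
  set T : ℕ → V₁ ⊗[ℂ] V₂ := fun p => (f₁ ^ p) v₁ ⊗ₜ[ℂ] (f₂ ^ (l - p)) v₂ with hT
  have hS : singVec f₁ f₂ v₁ v₂ m₁ m₂ l =
      ∑ p ∈ Finset.range (l + 1), singCoeff m₁ m₂ p (l - p) • T p := rfl
  have h_ef : TensorProduct.map e₁ f₂ (singVec f₁ f₂ v₁ v₂ m₁ m₂ l) =
      ∑ p ∈ Finset.range (l + 1),
        (-(((l : ℂ) - p) * (m₂ - (l - p) + 1)) * singCoeff m₁ m₂ p (l - p)) • T p := by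
    rw [hS, map_sum, Finset.sum_range_succ', Finset.sum_range_succ]
    simp only [hT, map_smul, TensorProduct.map_tmul, pow_zero, Module.End.one_apply, hv₁e,
      TensorProduct.zero_tmul, smul_zero, sub_self, zero_mul, neg_zero, zero_smul]
    congr 1
    refine Finset.sum_congr rfl fun p hp => ?_
    obtain ⟨q, rfl⟩ := Nat.exists_eq_add_of_lt (Finset.mem_range.mp hp)
    have e1 : p + q + 1 - (p + 1) = q := by omega
    have e2 : p + q + 1 - p = q + 1 := by omega
    rw [e1, e2, hsl1.e_pow_succ_f hv₁e hv₁h, ← Module.End.mul_apply, ← pow_succ',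
      ← TensorProduct.smul_tmul', smul_smul,
      singCoeff_succ_left (by omega) (by omega)]
    congr 1
    push_cast
    ring
  have h_fe : TensorProduct.map f₁ e₂ (singVec f₁ f₂ v₁ v₂ m₁ m₂ l) =
      ∑ p ∈ Finset.range (l + 1),
        (-((p : ℂ) * (m₁ - p + 1)) * singCoeff m₁ m₂ p (l - p)) • T p := by
    rw [hS, map_sum, Finset.sum_range_succ, Finset.sum_range_succ']
    simp only [hT, map_smul, TensorProduct.map_tmul, pow_zero, Module.End.one_apply, hv₂e,
      TensorProduct.tmul_zero, smul_zero, Nat.sub_self, Nat.cast_zero, zero_mul, neg_zero,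
      zero_smul]
    congr 1
    refine Finset.sum_congr rfl fun p hp => ?_
    obtain ⟨q, rfl⟩ := Nat.exists_eq_add_of_lt (Finset.mem_range.mp hp)
    have e1 : p + q + 1 - (p + 1) = q := by omega
    have e2 : p + q + 1 - p = q + 1 := by omega
    rw [e1, e2, hsl2.e_pow_succ_f hv₂e hv₂h, ← Module.End.mul_apply, ← pow_succ',
      TensorProduct.tmul_smul, smul_smul,
      ← neg_eq_iff_eq_neg.mpr (singCoeff_succ_left (by omega) (by omega))]
    congr 1
    push_cast
    ring
  have h_hh : TensorProduct.map h₁ h₂ (singVec f₁ f₂ v₁ v₂ m₁ m₂ l) =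
      ∑ p ∈ Finset.range (l + 1),
        (((m₁ : ℂ) - 2 * p) * (m₂ - 2 * (l - p)) * singCoeff m₁ m₂ p (l - p)) • T p := by
    rw [hS, map_sum]
    refine Finset.sum_congr rfl fun p hp => ?_
    have hpl : p ≤ l := Nat.lt_succ_iff.mp (Finset.mem_range.mp hp)
    rw [map_smul, TensorProduct.map_tmul, hsl1.h_pow_f hv₁h, hsl2.h_pow_f hv₂h,
      TensorProduct.smul_tmul_smul, smul_smul, Nat.cast_sub hpl, mul_comm]
  simp only [Omega12, LinearMap.add_apply, LinearMap.smul_apply, h_ef, h_fe, h_hh]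
  rw [hS, Finset.smul_sum, Finset.smul_sum, ← Finset.sum_add_distrib, ← Finset.sum_add_distrib]
  refine Finset.sum_congr rfl fun p _ => ?_
  simp only [smul_smul, ← add_smul]
  congr 1
  ring
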